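/- In the multi-server secure aggregation model with heterogeneous security constraints, let u' ∈ [U], m ∈ [M], n ∈ [N] be such that 𝒮_m ∩ 𝒯_n = ∅ and |(𝒮_m ∩ 𝒦_{{u'}}) ∪ 𝒦_{𝒰^{(m,n)}} ∪ 𝒯_n| ≤ K−1. Then H({Z_{u,v}}_{(u,v) ∈ (𝒮_m ∩ 𝒦_{{u'}}) ∪ 𝒦_{𝒰^{(m,n)}}} | {Z_{u,v}}_{(u,v)∈𝒯_n}) ≥ (|𝒮_m ∩ 𝒦_{{u'}}| + |𝒰^{(m,n)} ∖ {u'}|)·L. -/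

import Mathlib

open Finset

open scoped Classical

noncomputable section

/-- Probability that the random variable `X` takes the value `s`, under the weights `μ`. -/
def prb {Ω : Type} [Fintype Ω] (μ : Ω → ℝ) {α : Type} (X : Ω → α) (s : α) : ℝ :=
  ∑ ω ∈ Finset.univ.filter fun ω => X ω = s, μ ω

/-- Shannon entropy of `X` in `q`-ary units. -/
def ent (q : ℕ) {Ω : Type} [Fintype Ω] (μ : Ω → ℝ) {α : Type} [Fintype α] (X : Ω → α) : ℝ :=
  -∑ s : α, prb μ X s * Real.logb q (prb μ X s)

/-- Conditional entropy `H(X | Y)` in `q`-ary units. -/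
def condEnt (q : ℕ) {Ω : Type} [Fintype Ω] (μ : Ω → ℝ) {α β : Type} [Fintype α] [Fintype β]
    (X : Ω → α) (Y : Ω → β) : ℝ :=
  ent q μ (fun ω => (X ω, Y ω)) - ent q μ Y

/-- Conditional mutual information `I(X ; Y ∣ Z)` in `q`-ary units. -/
def mutInfo (q : ℕ) {Ω : Type} [Fintype Ω] (μ : Ω → ℝ) {α β γ : Type}
    [Fintype α] [Fintype β] [Fintype γ] (X : Ω → α) (Y : Ω → β) (Z : Ω → γ) : ℝ :=
  condEnt q μ X Z - condEnt q μ X fun ω => (Y ω, Z ω)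

/-- The joint random variable formed by the members of a family of random variables
indexed by a finset. -/
def restr {Ω ι α : Type} (Z : ι → Ω → α) (T : Finset ι) : Ω → { i // i ∈ T } → α :=
  fun ω i => Z i.1 ω

/-- The set of users `𝒦`: user `⟨u,v⟩` is the `v`-th user of server `u`. -/
abbrev Usr (U : ℕ) (V : Fin U → ℕ) : Type := Σ u : Fin U, Fin (V u)

/-- Total number of users, `K = ∑ u, V u`. -/
def Ktot (U : ℕ) (V : Fin U → ℕ) : ℕ := ∑ u, V u

/-- The users connected to server `u`, `𝒦_{{u}}`. -/
def Ksrv (U : ℕ) (V : Fin U → ℕ) (u : Fin U) : Finset (Usr U V) :=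
  Finset.univ.filter fun i => i.1 = u

/-- The users connected to a set of servers, `𝒦_𝒰`. -/
def KsrvSet (U : ℕ) (V : Fin U → ℕ) (A : Finset (Fin U)) : Finset (Usr U V) :=
  Finset.univ.filter fun i => i.1 ∈ A

/-- The set of servers `𝒰^{(m,n)}` associated with a security input set `Sm` and a
colluding set `Tn`. -/
def UServers (U : ℕ) (V : Fin U → ℕ) (Sm Tn : Finset (Usr U V)) : Finset (Fin U) :=
  Finset.univ.filter fun u =>
    (Sm ∩ Ksrv U V u).Nonempty ∧ ((Sm ∪ Tn) ∩ Ksrv U V u).card = V u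

/-- The set `(𝒮_m ∩ 𝒦_{{u}}) ∪ 𝒦_{𝒰^{(m,n)}} ∪ 𝒯_n`. -/
def BigB (U : ℕ) (V : Fin U → ℕ) (Sm Tn : Finset (Usr U V)) (u : Fin U) : Finset (Usr U V) :=
  (Sm ∩ Ksrv U V u) ∪ KsrvSet U V (UServers U V Sm Tn) ∪ Tn

/-- The implicit security input set `𝒮_I`. -/
def SImp (U : ℕ) (V : Fin U → ℕ) {M N : ℕ} (S : Fin M → Finset (Usr U V))
    (T : Fin N → Finset (Usr U V)) : Finset (Usr U V) :=
  Finset.univ.filter fun i =>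
    (∀ m, i ∉ S m) ∧
    ∃ u m n, (BigB U V (S m) (T n) u).card = Ktot U V - 1 ∧ i ∉ BigB U V (S m) (T n) u

/-- The total security input set `𝒮̄`. -/
def Sbar (U : ℕ) (V : Fin U → ℕ) {M N : ℕ} (S : Fin M → Finset (Usr U V))
    (T : Fin N → Finset (Usr U V)) : Finset (Usr U V) :=
  (Finset.univ.biUnion fun m => S m) ∪ SImp U V S T

/-- The set `𝒜_{u,m,n}`. -/
def Aset (U : ℕ) (V : Fin U → ℕ) {M N : ℕ} (S : Fin M → Finset (Usr U V))
    (T : Fin N → Finset (Usr U V)) (u : Fin U) (m : Fin M) (n : Fin N) : Finset (Usr U V) :=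
  BigB U V (S m) (T n) u ∩ Sbar U V S T

/-- `a* = max_{u,m,n} |𝒜_{u,m,n}|`. -/
def aStar (U : ℕ) (V : Fin U → ℕ) {M N : ℕ} (S : Fin M → Finset (Usr U V))
    (T : Fin N → Finset (Usr U V)) : ℕ :=
  Finset.univ.sup fun t : Fin U × Fin M × Fin N => (Aset U V S T t.1 t.2.1 t.2.2).card

/-- `|((𝒮_m ∩ 𝒦_{{u}}) ∪ 𝒯_n) ∩ 𝒮̄| + |𝒰^{(m,n)} ∖ {u}|`. -/
def eVal (U : ℕ) (V : Fin U → ℕ) {M N : ℕ} (S : Fin M → Finset (Usr U V))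
    (T : Fin N → Finset (Usr U V)) (u : Fin U) (m : Fin M) (n : Fin N) : ℕ :=
  (((S m ∩ Ksrv U V u) ∪ T n) ∩ Sbar U V S T).card + ((UServers U V (S m) (T n)).erase u).card

/-- `e* = max_{u,m,n} (|((𝒮_m ∩ 𝒦_{{u}}) ∪ 𝒯_n) ∩ 𝒮̄| + |𝒰^{(m,n)} ∖ {u}|)`. -/
def eStar (U : ℕ) (V : Fin U → ℕ) {M N : ℕ} (S : Fin M → Finset (Usr U V))
    (T : Fin N → Finset (Usr U V)) : ℕ :=
  Finset.univ.sup fun t : Fin U × Fin M × Fin N => eVal U V S T t.1 t.2.1 t.2.2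

/-- The set `𝒬_1`. -/
def Q1set (U : ℕ) (V : Fin U → ℕ) {M N : ℕ} (S : Fin M → Finset (Usr U V))
    (T : Fin N → Finset (Usr U V)) : Finset (Usr U V) :=
  (Finset.univ.filter fun t : Fin U × Fin M × Fin N =>
      (Aset U V S T t.1 t.2.1 t.2.2).card = (Sbar U V S T).card).biUnion
    fun t => BigB U V (S t.2.1) (T t.2.2) t.1

/-- The set `𝒬_2`. -/
def Q2set (U : ℕ) (V : Fin U → ℕ) {M N : ℕ} (S : Fin M → Finset (Usr U V))
    (T : Fin N → Finset (Usr U V)) : Finset (Usr U V) :=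
  (Finset.univ.filter fun t : Fin U × Fin M × Fin N =>
      eVal U V S T t.1 t.2.1 t.2.2 = eStar U V S T).biUnion
    fun t => BigB U V (S t.2.1) (T t.2.2) t.1

/-- The set `𝒬`. -/
def Qset (U : ℕ) (V : Fin U → ℕ) {M N : ℕ} (S : Fin M → Finset (Usr U V))
    (T : Fin N → Finset (Usr U V)) : Finset (Usr U V) :=
  if (Q1set U V S T).Nonempty then Q1set U V S T ∪ Q2set U V S T else ∅

/-- A secure-aggregation scheme: all structural, distributional, correctness and
security constraints of the multi-server secure aggregation model, with entropies in
`q`-ary units for `q = |F|`. -/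
def IsScheme (U : ℕ) (V : Fin U → ℕ) (M N : ℕ) (S : Fin M → Finset (Usr U V))
    (T : Fin N → Finset (Usr U V)) (F : Type) [Field F] [Fintype F]
    (Ω : Type) [Fintype Ω] (μ : Ω → ℝ) (L LX LY LZ LSig : ℕ)
    (W : Usr U V → Ω → Fin L → F) (Z : Usr U V → Ω → Fin LZ → F)
    (X : Usr U V → Ω → Fin LX → F) (Y : Fin U → Ω → Fin LY → F)
    (ZS : Ω → Fin LSig → F) : Prop :=
  let q := Fintype.card F
  (1 ≤ L) ∧
  (∀ ω, 0 ≤ μ ω) ∧ (∑ ω, μ ω = 1) ∧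
  -- each input consists of `L` i.i.d. uniform `q`-ary symbols
  (∀ i, ent q μ (W i) = L) ∧
  -- the inputs are mutually independent of each other and of all keys
  (ent q μ (fun ω => (restr W Finset.univ ω, restr Z Finset.univ ω)) =
    ent q μ (restr Z Finset.univ) + ∑ i, ent q μ (W i)) ∧
  -- the source key consists of `LSig` i.i.d. uniform `q`-ary symbols
  (ent q μ ZS = LSig) ∧
  -- the individual keys are deterministic functions of the source key
  (condEnt q μ (restr Z Finset.univ) ZS = 0) ∧
  -- each user message is a deterministic function of its input and key
  (∀ i, condEnt q μ (X i) (fun ω => (W i ω, Z i ω)) = 0) ∧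
  -- each server message is a deterministic function of its received messages
  (∀ u, condEnt q μ (Y u) (restr X (Ksrv U V u)) = 0) ∧
  -- correctness
  (∀ k, condEnt q μ (fun ω => ∑ i, W i ω)
    (fun ω => (restr Y (Finset.univ.erase k) ω, restr X (Ksrv U V k) ω)) = 0) ∧
  -- security
  (∀ k m n, mutInfo q μ
    (fun ω => (restr Y (Finset.univ.erase k) ω, restr X (Ksrv U V k) ω))
    (restr W (S m))
    (fun ω => (∑ i, W i ω, restr W (T n) ω, restr Z (T n) ω)) = 0)

/-- A rate tuple `(R_X, R_Y, R_{Z_Σ})` is achievable. -/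
def Achievable (U : ℕ) (V : Fin U → ℕ) (M N : ℕ) (S : Fin M → Finset (Usr U V))
    (T : Fin N → Finset (Usr U V)) (R : ℝ × ℝ × ℝ) : Prop :=
  ∃ (F : Type) (iF : Field F) (iFt : Fintype F) (Ω : Type) (iΩ : Fintype Ω)
    (μ : Ω → ℝ) (L LX LY LZ LSig : ℕ)
    (W : Usr U V → Ω → Fin L → F) (Z : Usr U V → Ω → Fin LZ → F)
    (X : Usr U V → Ω → Fin LX → F) (Y : Fin U → Ω → Fin LY → F)
    (ZS : Ω → Fin LSig → F),
    R.1 = (LX : ℝ) / (L : ℝ) ∧ R.2.1 = (LY : ℝ) / (L : ℝ) ∧ R.2.2 = (LSig : ℝ) / (L : ℝ) ∧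
    @IsScheme U V M N S T F iF iFt Ω iΩ μ L LX LY LZ LSig W Z X Y ZS

end

/-- `Y` is almost surely a function of `X`. -/
def Determines {Ω : Type} (μ : Ω → ℝ) {α β : Type} (X : Ω → α) (Y : Ω → β) : Prop :=
  ∀ ω ω', 0 < μ ω → 0 < μ ω' → X ω = X ω' → Y ω = Y ω'

theorem restr_eq_restr_iff {Ω ι α : Type} {R : ι → Ω → α} {A : Finset ι} {ω ω' : Ω} :
    restr R A ω = restr R A ω' ↔ ∀ i ∈ A, R i ω = R i ω' :=
  ⟨fun h i hi => congrFun h ⟨i, hi⟩, fun h => funext fun i => h i.1 i.2⟩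

section Entropy

variable {Ω : Type} [Fintype Ω] {μ : Ω → ℝ} {q : ℕ} {α β γ δ : Type}

theorem prb_nonneg (hμ : ∀ ω, 0 ≤ μ ω) (X : Ω → α) (s : α) : 0 ≤ prb μ X s :=
  Finset.sum_nonneg fun ω _ => hμ ω

theorem prb_pos (hμ : ∀ ω, 0 ≤ μ ω) (X : Ω → α) {ω : Ω} (h : 0 < μ ω) :
    0 < prb μ X (X ω) :=
  h.trans_le <| Finset.single_le_sum (f := μ) (fun ω _ => hμ ω) (by simp)

theorem Determines.prb_le (hμ : ∀ ω, 0 ≤ μ ω) {X : Ω → α} {Y : Ω → β}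
    (h : Determines μ X Y) {ω : Ω} (hω : 0 < μ ω) :
    prb μ X (X ω) ≤ prb μ Y (Y ω) := by
  unfold prb
  rw [Finset.sum_filter, Finset.sum_filter]
  refine Finset.sum_le_sum fun ω' _ => ?_
  rcases (hμ ω').eq_or_lt with h0 | h0
  · simp [← h0]
  · by_cases hX : X ω' = X ω
    · simp [hX, h ω' ω h0 hω hX]
    · rw [if_neg hX]
      split_ifs <;> simp [h0.le]

theorem sum_mul_comp [Fintype α] (X : Ω → α) (g : α → ℝ) :
    ∑ ω, μ ω * g (X ω) = ∑ s, prb μ X s * g s := by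
  rw [← Finset.sum_fiberwise Finset.univ X]
  refine Finset.sum_congr rfl fun s _ => ?_
  rw [prb, Finset.sum_mul]
  refine Finset.sum_congr rfl fun ω hω => ?_
  rw [(Finset.mem_filter.1 hω).2]

theorem sum_prb [Fintype α] (X : Ω → α) : ∑ s, prb μ X s = ∑ ω, μ ω := by
  simpa using (sum_mul_comp (μ := μ) X fun _ => 1).symm

theorem sum_prb_pair_left [Fintype α] (X : Ω → α) (Y : Ω → β) (y : β) :
    ∑ x, prb μ (fun ω => (X ω, Y ω)) (x, y) = prb μ Y y := by
  have h := Finset.sum_fiberwise (Finset.univ.filter fun ω => Y ω = y) X μ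
  rw [prb, ← h]
  refine Finset.sum_congr rfl fun x _ => ?_
  rw [prb, Finset.filter_filter]
  simp [and_comm]

theorem ent_eq_sum [Fintype α] (X : Ω → α) :
    ent q μ X = -∑ ω, μ ω * Real.logb q (prb μ X (X ω)) := by
  rw [sum_mul_comp X fun s => Real.logb q (prb μ X s), ent]

theorem sum_div_prb_le [Fintype α] (X : Ω → α) (f : α → ℝ)
    (hf : ∀ s, 0 ≤ f s) : ∑ ω, μ ω * (f (X ω) / prb μ X (X ω)) ≤ ∑ s, f s := by
  rw [sum_mul_comp X fun s => f s / prb μ X s]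
  refine Finset.sum_le_sum fun s _ => ?_
  by_cases h : prb μ X s = 0
  · simpa [h] using hf s
  · rw [mul_div_cancel₀ _ h]

theorem ent_le_of_determines (hq : 1 < q) (hμ : ∀ ω, 0 ≤ μ ω) [Fintype α] [Fintype β]
    {X : Ω → α} {Y : Ω → β} (h : Determines μ X Y) : ent q μ Y ≤ ent q μ X := by
  rw [ent_eq_sum, ent_eq_sum, neg_le_neg_iff]
  refine Finset.sum_le_sum fun ω _ => ?_
  rcases (hμ ω).eq_or_lt with h0 | h0
  · simp [← h0]
  · exact mul_le_mul_of_nonneg_left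
      (Real.logb_le_logb_of_le (by exact_mod_cast hq) (prb_pos hμ X h0) (h.prb_le hμ h0)) h0.le

theorem determines_of_condEnt_eq_zero (hq : 1 < q) (hμ : ∀ ω, 0 ≤ μ ω) [Fintype α] [Fintype β]
    {X : Ω → α} {Y : Ω → β} (h : condEnt q μ Y X = 0) : Determines μ X Y := by
  have hdet : Determines μ (fun ω => (Y ω, X ω)) X := fun _ _ _ _ h => congrArg Prod.snd h
  have hq' : (1 : ℝ) < q := by exact_mod_cast hq
  have hsum : ∑ ω, μ ω * Real.logb q (prb μ (fun ω => (Y ω, X ω)) (Y ω, X ω)) =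
      ∑ ω, μ ω * Real.logb q (prb μ X (X ω)) := by
    rw [condEnt, ent_eq_sum, ent_eq_sum] at h
    linarith
  have hterm := (Finset.sum_eq_sum_iff_of_le fun ω _ => by
    rcases (hμ ω).eq_or_lt with h0 | h0
    · simp [← h0]
    · exact mul_le_mul_of_nonneg_left
        (Real.logb_le_logb_of_le hq' (prb_pos hμ _ h0) (hdet.prb_le hμ h0)) h0.le).1 hsum
  intro ω ω' hω hω' hX
  by_contra hY
  have heq := Real.logb_injOn_pos hq' (prb_pos hμ (fun ω => (Y ω, X ω)) hω) (prb_pos hμ X hω)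
    (mul_left_cancel₀ hω.ne' (hterm ω (Finset.mem_univ _)))
  refine heq.not_lt ?_
  refine Finset.sum_lt_sum_of_subset (i := ω') ?_ ?_ ?_ hω' fun _ _ _ => hμ _
  · intro x
    simp +contextual
  · simp [hX]
  · simp [Ne.symm hY]

theorem ent_le_logb_card (hq : 1 < q) (hμ : ∀ ω, 0 ≤ μ ω) (hμ1 : ∑ ω, μ ω = 1)
    [Fintype α] (X : Ω → α) : ent q μ X ≤ Real.logb q (Fintype.card α) := by
  have hlq : 0 < Real.log q := Real.log_pos (by exact_mod_cast hq)
  obtain ⟨ω₀⟩ : Nonempty Ω := by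
    by_contra h
    rw [not_nonempty_iff] at h
    simp at hμ1
  have hn : (0 : ℝ) < Fintype.card α := by
    exact_mod_cast Fintype.card_pos_iff.2 ⟨X ω₀⟩
  have key : ∑ ω, μ ω * (1 - (Fintype.card α : ℝ)⁻¹ / prb μ X (X ω)) ≤
      ∑ ω, μ ω * (Real.log (prb μ X (X ω)) + Real.log (Fintype.card α)) := by
    refine Finset.sum_le_sum fun ω _ => ?_
    rcases (hμ ω).eq_or_lt with h0 | h0
    · simp [← h0]
    · have hp := prb_pos hμ X h0
      rw [← Real.log_mul hp.ne' hn.ne']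
      refine mul_le_mul_of_nonneg_left ?_ h0.le
      rw [div_eq_mul_inv, ← mul_inv_rev]
      exact Real.one_sub_inv_le_log_of_pos (mul_pos hp hn)
  have hle := sum_div_prb_le (μ := μ) X (fun _ => (Fintype.card α : ℝ)⁻¹) fun _ => by positivity
  simp only [mul_sub, mul_add, mul_one, Finset.sum_sub_distrib, Finset.sum_add_distrib,
    ← Finset.sum_mul, hμ1, one_mul] at key
  simp only [Finset.sum_const, Finset.card_univ, nsmul_eq_mul, mul_inv_cancel₀ hn.ne'] at hle
  rw [ent_eq_sum]
  simp only [Real.logb, ← mul_div_assoc, ← Finset.sum_div]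
  rw [← neg_div]
  gcongr
  linarith

theorem condEnt_pair_le (hq : 1 < q) (hμ : ∀ ω, 0 ≤ μ ω)
    [Fintype α] [Fintype β] [Fintype γ] (X : Ω → α) (Y : Ω → β) (Z : Ω → γ) :
    condEnt q μ X (fun ω => (Y ω, Z ω)) ≤ condEnt q μ X Z := by
  have hlq : 0 < Real.log q := Real.log_pos (by exact_mod_cast hq)
  set pXYZ := prb μ fun ω => (X ω, Y ω, Z ω) with hXYZ
  set pXZ := prb μ fun ω => (X ω, Z ω) with hXZ
  set pYZ := prb μ fun ω => (Y ω, Z ω) with hYZ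
  set pZ := prb μ Z with hZ
  have key : ∑ ω, μ ω * (1 - pXZ (X ω, Z ω) * pYZ (Y ω, Z ω) / pZ (Z ω) /
        pXYZ (X ω, Y ω, Z ω)) ≤
      ∑ ω, μ ω * (Real.log (pXYZ (X ω, Y ω, Z ω)) + Real.log (pZ (Z ω))
        - Real.log (pXZ (X ω, Z ω)) - Real.log (pYZ (Y ω, Z ω))) := by
    refine Finset.sum_le_sum fun ω _ => ?_
    rcases (hμ ω).eq_or_lt with h0 | h0
    · simp [← h0]
    · have h1 : 0 < pXYZ (X ω, Y ω, Z ω) := prb_pos hμ (fun ω => (X ω, Y ω, Z ω)) h0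
      have h2 : 0 < pXZ (X ω, Z ω) := prb_pos hμ (fun ω => (X ω, Z ω)) h0
      have h3 : 0 < pYZ (Y ω, Z ω) := prb_pos hμ (fun ω => (Y ω, Z ω)) h0
      have h4 : 0 < pZ (Z ω) := prb_pos hμ Z h0
      rw [sub_sub, ← Real.log_mul h1.ne' h4.ne', ← Real.log_mul h2.ne' h3.ne',
        ← Real.log_div (by positivity) (by positivity)]
      refine mul_le_mul_of_nonneg_left ?_ h0.le
      rw [div_div, mul_comm (pZ _), ← inv_div]
      exact Real.one_sub_inv_le_log_of_pos (div_pos (mul_pos h1 h4) (mul_pos h2 h3))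
  have hle := sum_div_prb_le (μ := μ) (fun ω => (X ω, Y ω, Z ω))
    (fun s => pXZ (s.1, s.2.2) * pYZ s.2 / pZ s.2.2) fun s =>
      div_nonneg (mul_nonneg (prb_nonneg hμ _ _) (prb_nonneg hμ _ _)) (prb_nonneg hμ _ _)
  have hmarg : ∑ s : α × β × γ, pXZ (s.1, s.2.2) * pYZ s.2 / pZ s.2.2 ≤ ∑ ω, μ ω := by
    rw [← sum_prb fun ω => (Y ω, Z ω), Fintype.sum_prod_type_right]
    refine Finset.sum_le_sum fun t _ => ?_
    dsimp only
    rw [← Finset.sum_div, ← Finset.sum_mul, sum_prb_pair_left, mul_div_right_comm]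
    exact mul_le_of_le_one_left (prb_nonneg hμ _ _) (div_self_le_one _)
  simp only [mul_sub, mul_add, mul_one, Finset.sum_sub_distrib, Finset.sum_add_distrib] at key
  simp only [condEnt, ent_eq_sum, Real.logb, ← mul_div_assoc, ← Finset.sum_div]
  rw [← hXYZ, ← hXZ, ← hYZ, ← hZ, ← neg_div, ← neg_div, ← neg_div, ← neg_div, ← sub_div, ← sub_div]
  refine div_le_div_of_nonneg_right ?_ hlq.le
  linarith

theorem condEnt_le_of_determines (hq : 1 < q) (hμ : ∀ ω, 0 ≤ μ ω)
    [Fintype α] [Fintype β] [Fintype γ] (X : Ω → α) {Y : Ω → β} {Z : Ω → γ}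
    (h : Determines μ Y Z) : condEnt q μ X Y ≤ condEnt q μ X Z := by
  have h1 := condEnt_pair_le hq hμ X Y Z
  have h2 : ent q μ (fun ω => (Y ω, Z ω)) ≤ ent q μ Y :=
    ent_le_of_determines hq hμ fun ω ω' hω hω' e => Prod.ext e (h ω ω' hω hω' e)
  have h3 : ent q μ (fun ω => (X ω, Y ω)) ≤ ent q μ (fun ω => (X ω, Y ω, Z ω)) :=
    ent_le_of_determines hq hμ fun ω ω' hω hω' e => by
      simp only [Prod.mk.injEq] at e ⊢
      exact ⟨e.1, e.2.1⟩
  unfold condEnt at h1 ⊢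
  linarith

theorem condEnt_le_condEnt_of_determines (hq : 1 < q) (hμ : ∀ ω, 0 ≤ μ ω)
    [Fintype α] [Fintype β] [Fintype γ] {X : Ω → α} {Y : Ω → β} {Z : Ω → γ}
    (h : Determines μ (fun ω => (X ω, Z ω)) Y) : condEnt q μ Y Z ≤ condEnt q μ X Z := by
  have : ent q μ (fun ω => (Y ω, Z ω)) ≤ ent q μ (fun ω => (X ω, Z ω)) :=
    ent_le_of_determines hq hμ fun ω ω' hω hω' e =>
      Prod.ext (h ω ω' hω hω' e) (Prod.mk.inj e).2
  unfold condEnt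
  linarith

theorem condEnt_le_ent (hq : 1 < q) (hμ : ∀ ω, 0 ≤ μ ω) (hμ1 : ∑ ω, μ ω = 1)
    [Fintype α] [Fintype β] (X : Ω → α) (Y : Ω → β) : condEnt q μ X Y ≤ ent q μ X := by
  have h1 := condEnt_le_of_determines hq hμ X (Y := Y) (Z := fun _ => ()) fun _ _ _ _ _ => rfl
  have h2 : ent q μ (fun ω => (X ω, ())) ≤ ent q μ X :=
    ent_le_of_determines hq hμ fun _ _ _ _ e => Prod.ext e rfl
  have h3 : ent q μ (fun _ : Ω => ()) = 0 := by
    rw [ent_eq_sum]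
    simp [prb, hμ1]
  unfold condEnt at h1 ⊢
  linarith

/-- Data processing: a function of a conditionally independent variable is conditionally
independent. -/
theorem condEnt_le_condEnt_pair_of_mutInfo_eq_zero (hq : 1 < q) (hμ : ∀ ω, 0 ≤ μ ω)
    [Fintype α] [Fintype β] [Fintype γ] [Fintype δ]
    {X : Ω → α} {X' : Ω → δ} {Y : Ω → β} {Z : Ω → γ}
    (h : mutInfo q μ X Y Z = 0) (hX : Determines μ X X') :
    condEnt q μ X' Z ≤ condEnt q μ X' fun ω => (Y ω, Z ω) := by
  have h1 := condEnt_pair_le hq hμ X Y fun ω => (X' ω, Z ω)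
  have h2 : ent q μ (fun ω => (X ω, X' ω, Z ω)) ≤ ent q μ (fun ω => (X ω, Z ω)) :=
    ent_le_of_determines hq hμ fun ω ω' hω hω' e => by
      simp only [Prod.mk.injEq] at e ⊢
      exact ⟨e.1, hX ω ω' hω hω' e.1, e.2⟩
  have h3 : ent q μ (fun ω => (X ω, Y ω, Z ω)) ≤ ent q μ (fun ω => (X ω, Y ω, X' ω, Z ω)) :=
    ent_le_of_determines hq hμ fun ω ω' hω hω' e => by
      simp only [Prod.mk.injEq] at e ⊢
      exact ⟨e.1, e.2.1, e.2.2.2⟩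
  have h4 : ent q μ (fun ω => (Y ω, X' ω, Z ω)) ≤ ent q μ (fun ω => (X' ω, Y ω, Z ω)) :=
    ent_le_of_determines hq hμ fun ω ω' hω hω' e => by
      simp only [Prod.mk.injEq] at e ⊢
      exact ⟨e.2.1, e.1, e.2.2⟩
  unfold mutInfo at h
  unfold condEnt at h h1 ⊢
  linarith

theorem ent_restr_le (hq : 1 < q) (hμ : ∀ ω, 0 ≤ μ ω) (hμ1 : ∑ ω, μ ω = 1)
    {ι : Type} [DecidableEq ι]
    [Fintype α] [Fintype β] (R : ι → Ω → α) (P : Ω → β) (A : Finset ι) :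
    ent q μ (fun ω => (restr R A ω, P ω)) ≤ ent q μ P + ∑ i ∈ A, ent q μ (R i) := by
  induction A using Finset.induction_on with
  | empty =>
    simpa using ent_le_of_determines hq hμ fun ω ω' _ _ e =>
      Prod.ext (restr_eq_restr_iff.2 (by simp)) e
  | insert i A hi ih =>
    have h1 := condEnt_le_ent hq hμ hμ1 (R i) fun ω => (restr R A ω, P ω)
    have h2 : ent q μ (fun ω => (restr R (insert i A) ω, P ω)) ≤
        ent q μ (fun ω => (R i ω, restr R A ω, P ω)) :=
      ent_le_of_determines hq hμ fun ω ω' _ _ e => by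
        simp only [Prod.mk.injEq, restr_eq_restr_iff, Finset.forall_mem_insert] at e ⊢
        exact ⟨⟨e.1, e.2.1⟩, e.2.2⟩
    rw [Finset.sum_insert hi]
    unfold condEnt at h1
    linarith

theorem card_mul_le_condEnt_restr (hq : 1 < q) (hμ : ∀ ω, 0 ≤ μ ω) {ι : Type} [DecidableEq ι]
    [Fintype α] [Fintype β] (R : ι → Ω → α) (P : Ω → β) (c : ℝ) (A : Finset ι)
    (h : ∀ i ∈ A, c ≤ condEnt q μ (R i) fun ω => (restr R (A.erase i) ω, P ω)) :
    A.card * c ≤ condEnt q μ (restr R A) P := by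
  induction A using Finset.induction_on with
  | empty =>
    simpa [condEnt] using ent_le_of_determines hq hμ
      (X := fun ω => (restr R ∅ ω, P ω)) (Y := P) fun _ _ _ _ e => congrArg Prod.snd e
  | insert i A hi ih =>
    have h1 := ih fun j hj => (h j (Finset.mem_insert_of_mem hj)).trans <|
      condEnt_le_of_determines hq hμ _ fun ω ω' _ _ e => by
        simp only [Prod.mk.injEq, restr_eq_restr_iff] at e ⊢
        exact ⟨fun k hk => e.1 k (Finset.erase_subset_erase _ (Finset.subset_insert _ _) hk), e.2⟩
    have h2 := h i (Finset.mem_insert_self _ _)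
    rw [Finset.erase_insert hi] at h2
    have h3 : ent q μ (fun ω => (R i ω, restr R A ω, P ω)) ≤
        ent q μ (fun ω => (restr R (insert i A) ω, P ω)) :=
      ent_le_of_determines hq hμ fun ω ω' _ _ e => by
        simp only [Prod.mk.injEq, restr_eq_restr_iff, Finset.forall_mem_insert] at e ⊢
        exact ⟨e.1.1, e.1.2, e.2⟩
    rw [Finset.card_insert_of_notMem hi]
    push_cast
    unfold condEnt at h1 h2 ⊢
    linarith

theorem condEnt_pair_eq_add (hq : 1 < q) (hμ : ∀ ω, 0 ≤ μ ω) [Fintype α] [Fintype β] [Fintype γ]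
    (X : Ω → α) (Y : Ω → β) (Z : Ω → γ) :
    condEnt q μ (fun ω => (X ω, Y ω)) Z =
      condEnt q μ X (fun ω => (Y ω, Z ω)) + condEnt q μ Y Z := by
  have h : ent q μ (fun ω => ((X ω, Y ω), Z ω)) = ent q μ (fun ω => (X ω, Y ω, Z ω)) := by
    apply le_antisymm <;> refine ent_le_of_determines hq hμ fun ω ω' _ _ e => ?_ <;>
      simpa only [Prod.mk.injEq, and_assoc] using e
  unfold condEnt
  linarith

/-- Conditioning on a variable whose entropy is not reduced by `X` and `Z` leaves `H(X | Z)`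
unchanged. -/
theorem condEnt_le_condEnt_pair_of_ent_le (hq : 1 < q) (hμ : ∀ ω, 0 ≤ μ ω)
    (hμ1 : ∑ ω, μ ω = 1) [Fintype α] [Fintype β] [Fintype γ]
    {X : Ω → α} {Y : Ω → β} {Z : Ω → γ}
    (h : ent q μ Y ≤ condEnt q μ Y fun ω => (X ω, Z ω)) :
    condEnt q μ X Z ≤ condEnt q μ X fun ω => (Y ω, Z ω) := by
  have h1 := condEnt_le_ent hq hμ hμ1 Y Z
  have h2 : ent q μ (fun ω => (Y ω, X ω, Z ω)) ≤ ent q μ (fun ω => (X ω, Y ω, Z ω)) :=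
    ent_le_of_determines hq hμ fun ω ω' _ _ e => by
      simp only [Prod.mk.injEq] at e ⊢
      exact ⟨e.2.1, e.1, e.2.2⟩
  unfold condEnt at h h1 ⊢
  linarith

/-- The sum of independent inputs keeps full entropy given the keys and all inputs but one. -/
theorem ent_le_condEnt_sum (hq : 1 < q) (hμ : ∀ ω, 0 ≤ μ ω) (hμ1 : ∑ ω, μ ω = 1)
    {ι : Type} [Fintype ι] [DecidableEq ι] [Fintype α] [AddCommGroup α] [Fintype β]
    (W : ι → Ω → α) (P : Ω → β)
    (hind : ent q μ (fun ω => (restr W Finset.univ ω, P ω)) = ent q μ P + ∑ i, ent q μ (W i))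
    (i : ι) :
    ent q μ (W i) ≤
      condEnt q μ (fun ω => ∑ j, W j ω) fun ω => (restr W (Finset.univ.erase i) ω, P ω) := by
  have h1 := ent_restr_le hq hμ hμ1 W P (Finset.univ.erase i)
  have h2 := Finset.add_sum_erase Finset.univ (fun i => ent q μ (W i)) (Finset.mem_univ i)
  have h3 : ent q μ (fun ω => (restr W Finset.univ ω, P ω)) ≤
      ent q μ (fun ω => (∑ j, W j ω, restr W (Finset.univ.erase i) ω, P ω)) :=
    ent_le_of_determines hq hμ fun ω ω' _ _ e => by
      simp only [Prod.mk.injEq, restr_eq_restr_iff] at e ⊢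
      obtain ⟨hs, he, hP⟩ := e
      refine ⟨fun j _ => ?_, hP⟩
      by_cases hj : j = i
      · subst hj
        rw [← Finset.add_sum_erase _ _ (Finset.mem_univ j),
          ← Finset.add_sum_erase _ _ (Finset.mem_univ j), Finset.sum_congr rfl he] at hs
        exact add_right_cancel hs
      · exact he j (by simp [hj])
  unfold condEnt
  linarith

end Entropy

theorem fst_mem_UServers {U : ℕ} {V : Fin U → ℕ} {A B : Finset (Usr U V)} {i : Usr U V}
    (h : i.1 ∈ UServers U V A B) : i ∈ A ∪ B := by
  have hcard : (Ksrv U V i.1).card = V i.1 := by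
    have : Ksrv U V i.1 = (Finset.univ : Finset (Fin (V i.1))).map
        ⟨Sigma.mk i.1, sigma_mk_injective⟩ := by
      ext ⟨u, v⟩
      simp only [Ksrv, Finset.mem_filter, Finset.mem_univ, true_and, Finset.mem_map,
        Function.Embedding.coeFn_mk]
      constructor
      · rintro rfl
        exact ⟨v, rfl⟩
      · rintro ⟨w, hw⟩
        exact (congrArg Sigma.fst hw).symm
    simp [this]
  have hle := Finset.eq_of_subset_of_card_le
    (Finset.inter_subset_right : (A ∪ B) ∩ Ksrv U V i.1 ⊆ Ksrv U V i.1)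
    (by rw [hcard, (Finset.mem_filter.1 h).2.2])
  have hi : i ∈ Ksrv U V i.1 := by simp [Ksrv]
  rw [← hle] at hi
  exact (Finset.mem_inter.1 hi).1

theorem stmt13_lemma5
    (U : ℕ) (hU : 3 ≤ U) (V : Fin U → ℕ) (hV : ∀ u, 1 ≤ V u)
    (M N : ℕ) (S : Fin M → Finset (Usr U V)) (T : Fin N → Finset (Usr U V))
    (hSmono : ∀ (m : Fin M) (A : Finset (Usr U V)), A ⊆ S m → ∃ m', S m' = A)
    (hTmono : ∀ (n : Fin N) (A : Finset (Usr U V)), A ⊆ T n → ∃ n', T n' = A)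
    (hSne : (Finset.univ.biUnion fun m => S m).Nonempty)
    (hTcard : ∀ n, (T n).card ≤ Ktot U V - 2)
    (F : Type) [Field F] [Fintype F] (Ω : Type) [Fintype Ω] (μ : Ω → ℝ)
    (L LX LY LZ LSig : ℕ)
    (W : Usr U V → Ω → Fin L → F) (Z : Usr U V → Ω → Fin LZ → F)
    (X : Usr U V → Ω → Fin LX → F) (Y : Fin U → Ω → Fin LY → F)
    (ZS : Ω → Fin LSig → F)
    (hScheme : IsScheme U V M N S T F Ω μ L LX LY LZ LSig W Z X Y ZS)
    (u' : Fin U) (m : Fin M) (n : Fin N)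
    (hdisj : S m ∩ T n = ∅)
    (hcard : (BigB U V (S m) (T n) u').card ≤ Ktot U V - 1) :
    (((S m ∩ Ksrv U V u').card : ℝ) + (((UServers U V (S m) (T n)).erase u').card : ℝ)) * L ≤
      condEnt (Fintype.card F) μ
        (restr Z ((S m ∩ Ksrv U V u') ∪ KsrvSet U V (UServers U V (S m) (T n))))
        (restr Z (T n)) := by
  obtain ⟨-, hμ, hμ1, hW, hind, -, -, hX, hY, hcor, hsec⟩ := hScheme
  have hq : 1 < Fintype.card F := Fintype.one_lt_card
  have hXdet := fun i => determines_of_condEnt_eq_zero hq hμ (hX i)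
  have hYdet := fun u => determines_of_condEnt_eq_zero hq hμ (hY u)
  have hcordet := fun k => determines_of_condEnt_eq_zero hq hμ (hcor k)
  set A := S m ∩ Ksrv U V u'
  set 𝒰 := UServers U V (S m) (T n)
  set B := 𝒰.erase u'
  let E (i : Usr U V) (ω : Ω) := (restr W (Finset.univ.erase i) ω, restr Z (Finset.univ.erase i) ω)
  let P (ω : Ω) := (restr W (T n) ω, restr Z (T n) ω)
  let Q (ω : Ω) := (restr X A ω, restr Y B ω)
  let sumW (ω : Ω) := ∑ i, W i ω
  have hXE : ∀ i j, j ≠ i → Determines μ (E i) (X j) := fun i j hj ω ω' hω hω' e => by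
    simp only [E, Prod.mk.injEq, restr_eq_restr_iff, Finset.mem_erase, Finset.mem_univ,
      and_true] at e
    exact hXdet j ω ω' hω hω' (Prod.ext (e.1 j hj) (e.2 j hj))
  have hYE : ∀ (i : Usr U V) u, i.1 ≠ u → Determines μ (E i) (Y u) :=
    fun i u hu ω ω' hω hω' e => hYdet u ω ω' hω hω' <| restr_eq_restr_iff.2 fun j hj => by
      refine hXE i j ?_ ω ω' hω hω' e
      rintro rfl
      exact hu (Finset.mem_filter.1 hj).2
  have hPE : ∀ i ∉ T n, Determines μ (E i) P := fun i hi ω ω' _ _ e => by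
    simp only [E, P, Prod.mk.injEq, restr_eq_restr_iff, Finset.mem_erase, Finset.mem_univ,
      and_true] at e ⊢
    exact ⟨fun j hj => e.1 j (ne_of_mem_of_not_mem hj hi),
      fun j hj => e.2 j (ne_of_mem_of_not_mem hj hi)⟩
  have hsumE : ∀ i, (L : ℝ) ≤ condEnt (Fintype.card F) μ sumW (E i) := fun i => by
    rw [← hW i]
    refine (ent_le_condEnt_sum hq hμ hμ1 W (restr Z Finset.univ) hind i).trans
      (condEnt_le_of_determines hq hμ _ fun ω ω' _ _ e => ?_)
    simp only [E, Prod.mk.injEq, restr_eq_restr_iff] at e ⊢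
    exact ⟨e.1, fun j _ => e.2 j (Finset.mem_univ _)⟩
  have hXent : ∀ i, (L : ℝ) ≤ condEnt (Fintype.card F) μ (X i) (E i) := fun i =>
    (hsumE i).trans <| condEnt_le_condEnt_of_determines hq hμ fun ω ω' hω hω' e => by
      simp only [Prod.mk.injEq] at e
      refine hcordet i.1 ω ω' hω hω' (Prod.ext (restr_eq_restr_iff.2 fun u hu => ?_)
        (restr_eq_restr_iff.2 fun j _ => ?_))
      · exact hYE i u (Finset.ne_of_mem_erase hu).symm ω ω' hω hω' e.2
      · by_cases hj : j = i
        · exact hj ▸ e.1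
        · exact hXE i j hj ω ω' hω hω' e.2
  have hYent : ∀ i : Usr U V, i.1 ≠ u' →
      (L : ℝ) ≤ condEnt (Fintype.card F) μ (Y i.1) (E i) := fun i hi =>
    (hsumE i).trans <| condEnt_le_condEnt_of_determines hq hμ fun ω ω' hω hω' e => by
      simp only [Prod.mk.injEq] at e
      refine hcordet u' ω ω' hω hω' (Prod.ext (restr_eq_restr_iff.2 fun u _ => ?_)
        (restr_eq_restr_iff.2 fun j hj => ?_))
      · by_cases hu : i.1 = u
        · exact hu ▸ e.1
        · exact hYE i u hu ω ω' hω hω' e.2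
      · refine hXE i j ?_ ω ω' hω hω' e.2
        rintro rfl
        exact hi (Finset.mem_filter.1 hj).2
  have hST : ∀ i ∈ S m, i ∉ T n := fun i hi => Finset.disjoint_left.1
    (Finset.disjoint_iff_inter_eq_empty.2 hdisj) hi
  have hXchain : (A.card : ℝ) * L ≤ condEnt (Fintype.card F) μ (restr X A)
      (fun ω => (restr Y B ω, P ω)) := by
    refine card_mul_le_condEnt_restr hq hμ X _ _ A fun i hi => (hXent i).trans
      (condEnt_le_of_determines hq hμ _ fun ω ω' hω hω' e => ?_)
    have hi' := Finset.mem_inter.1 hi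
    refine Prod.ext (restr_eq_restr_iff.2 fun j hj => ?_)
      (Prod.ext (restr_eq_restr_iff.2 fun u hu => ?_) (hPE i (hST i hi'.1) ω ω' hω hω' e))
    · exact hXE i j (Finset.ne_of_mem_erase hj) ω ω' hω hω' e
    · refine hYE i u ?_ ω ω' hω hω' e
      rw [(Finset.mem_filter.1 hi'.2).2]
      exact (Finset.ne_of_mem_erase hu).symm
  have hYchain : (B.card : ℝ) * L ≤ condEnt (Fintype.card F) μ (restr Y B) P := by
    refine card_mul_le_condEnt_restr hq hμ Y _ _ B fun u hu => ?_
    obtain ⟨i, hi⟩ := (Finset.mem_filter.1 (Finset.mem_of_mem_erase hu)).2.1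
    have hi' := Finset.mem_inter.1 hi
    obtain rfl : i.1 = u := (Finset.mem_filter.1 hi'.2).2
    refine (hYent i (Finset.ne_of_mem_erase hu)).trans
      (condEnt_le_of_determines hq hμ _ fun ω ω' hω hω' e => ?_)
    exact Prod.ext (restr_eq_restr_iff.2 fun v hv =>
      hYE i v (Finset.ne_of_mem_erase hv).symm ω ω' hω hω' e) (hPE i (hST i hi'.1) ω ω' hω hω' e)
  have hcardUsr : Fintype.card (Usr U V) = Ktot U V := by simp [Ktot]
  obtain ⟨i₀, hi₀⟩ : ∃ i, i ∉ BigB U V (S m) (T n) u' := by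
    by_contra! hall
    have hpos : 0 < Ktot U V := by
      rw [← hcardUsr]
      exact Fintype.card_pos_iff.2 ⟨⟨u', ⟨0, hV u'⟩⟩⟩
    rw [Finset.eq_univ_of_forall hall, Finset.card_univ, hcardUsr] at hcard
    omega
  simp only [BigB, KsrvSet, Finset.mem_union, Finset.mem_filter, Finset.mem_univ, true_and,
    not_or] at hi₀
  have hsumQ : ent (Fintype.card F) μ sumW ≤
      condEnt (Fintype.card F) μ sumW fun ω => (Q ω, P ω) := by
    have hle : ent (Fintype.card F) μ sumW ≤ L := by
      refine (ent_le_logb_card hq hμ hμ1 sumW).trans_eq ?_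
      rw [Fintype.card_fun, Fintype.card_fin, Nat.cast_pow, Real.logb_pow,
        Real.logb_self_eq_one (by exact_mod_cast hq), mul_one]
    refine hle.trans ((hsumE i₀).trans (condEnt_le_of_determines hq hμ _ fun ω ω' hω hω' e => ?_))
    refine Prod.ext (Prod.ext (restr_eq_restr_iff.2 fun j hj => ?_)
      (restr_eq_restr_iff.2 fun u hu => ?_)) (hPE i₀ hi₀.2 ω ω' hω hω' e)
    · exact hXE i₀ j (ne_of_mem_of_not_mem hj hi₀.1.1) ω ω' hω hω' e
    · exact hYE i₀ u (ne_of_mem_of_not_mem (Finset.mem_of_mem_erase hu) hi₀.1.2).symm ω ω' hω hω' e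
  have hQview : Determines μ
      (fun ω => (restr Y (Finset.univ.erase u') ω, restr X (Ksrv U V u') ω)) Q :=
    fun ω ω' _ _ e => by
      simp only [Q, Prod.mk.injEq, restr_eq_restr_iff] at e ⊢
      exact ⟨fun j hj => e.2 j (Finset.mem_inter.1 hj).2,
        fun u hu => e.1 u (Finset.erase_subset_erase _ (Finset.subset_univ _) hu)⟩
  have hQkeys : Determines μ (fun ω => (restr Z (A ∪ KsrvSet U V 𝒰) ω, restr W (S m) ω, P ω)) Q :=
    fun ω ω' hω hω' e => by
      simp only [P, Prod.mk.injEq, restr_eq_restr_iff] at e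
      obtain ⟨hZ, hS, hT, -⟩ := e
      refine Prod.ext (restr_eq_restr_iff.2 fun i hi => ?_) (restr_eq_restr_iff.2 fun u hu =>
        hYdet u ω ω' hω hω' (restr_eq_restr_iff.2 fun i hi => ?_))
      · exact hXdet i ω ω' hω hω' (Prod.ext (hS i (Finset.mem_inter.1 hi).1)
          (hZ i (Finset.mem_union_left _ hi)))
      · have hi𝒰 : i.1 ∈ 𝒰 := by
          rw [(Finset.mem_filter.1 hi).2]
          exact Finset.mem_of_mem_erase hu
        refine hXdet i ω ω' hω hω' (Prod.ext ?_ (hZ i (Finset.mem_union_right _ ?_)))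
        · exact (Finset.mem_union.1 (fst_mem_UServers hi𝒰)).elim (hS i) (hT i)
        · exact Finset.mem_filter.2 ⟨Finset.mem_univ _, hi𝒰⟩
  calc ((A.card : ℝ) + B.card) * L
      ≤ condEnt (Fintype.card F) μ Q P := by
        rw [condEnt_pair_eq_add hq hμ]
        linarith
    _ ≤ condEnt (Fintype.card F) μ Q fun ω => (sumW ω, P ω) :=
        condEnt_le_condEnt_pair_of_ent_le hq hμ hμ1 hsumQ
    _ ≤ condEnt (Fintype.card F) μ Q fun ω => (restr W (S m) ω, sumW ω, P ω) :=
        condEnt_le_condEnt_pair_of_mutInfo_eq_zero hq hμ (hsec u' m n) hQview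
    _ ≤ condEnt (Fintype.card F) μ Q fun ω => (restr W (S m) ω, P ω) :=
        condEnt_le_of_determines hq hμ _ fun ω ω' _ _ e => by
          simp only [Prod.mk.injEq] at e ⊢
          exact ⟨e.1, e.2.2⟩
    _ ≤ condEnt (Fintype.card F) μ (restr Z (A ∪ KsrvSet U V 𝒰))
          fun ω => (restr W (S m) ω, P ω) :=
        condEnt_le_condEnt_of_determines hq hμ hQkeys
    _ ≤ condEnt (Fintype.card F) μ (restr Z (A ∪ KsrvSet U V 𝒰)) (restr Z (T n)) :=
        condEnt_le_of_determines hq hμ _ fun ω ω' _ _ e => by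
          simp only [P, Prod.mk.injEq] at e
          exact e.2.2
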